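/- Soundness and completeness of SC_TML: a sequent Γ ⇒ Δ is derivable in SC_TML if and only if every valuation v into M4m satisfies Γ ⇒ Δ, i.e., for every valuation v, either v(γ) ∉ D for some γ ∈ Γ or v(δ) ∈ D for some δ ∈ Δ. -/

import Mathlib

/-- Formulas built from propositional variables by the connectives `∧`, `∨`, `¬`, `□`
(no `⊥`). -/
inductive Formula : Type where
  | var : ℕ → Formula
  | and : Formula → Formula → Formula
  | or : Formula → Formula → Formula
  | neg : Formula → Formula
  | box : Formula → Formula
deriving DecidableEq
/-- The two-sided sequent calculus `SC_TML`.  `SCder c Γ Δ` means the sequent `Γ ⇒ Δ`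
has a derivation; when `c = false` the cut rule is not allowed (cut-free derivability),
`SCder true` is plain derivability. -/
inductive SCder : Bool → Finset Formula → Finset Formula → Prop where
  | ax (c : Bool) (α : Formula) : SCder c {α} {α}
  | weakL {c Γ Δ} (α : Formula) : SCder c Γ Δ → SCder c (insert α Γ) Δ
  | weakR {c Γ Δ} (α : Formula) : SCder c Γ Δ → SCder c Γ (insert α Δ)
  | cut {Γ Δ : Finset Formula} {α : Formula} :
      SCder true Γ (insert α Δ) → SCder true (insert α Γ) Δ → SCder true Γ Δ
  | andL {c Γ Δ} (α β : Formula) :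
      SCder c (insert α (insert β Γ)) Δ → SCder c (insert (α.and β) Γ) Δ
  | andR {c Γ Δ} (α β : Formula) :
      SCder c Γ (insert α Δ) → SCder c Γ (insert β Δ) → SCder c Γ (insert (α.and β) Δ)
  | nandL {c Γ Δ} (α β : Formula) :
      SCder c (insert α.neg Γ) Δ → SCder c (insert β.neg Γ) Δ →
      SCder c (insert (α.and β).neg Γ) Δ
  | nandR {c Γ Δ} (α β : Formula) :
      SCder c Γ (insert α.neg (insert β.neg Δ)) → SCder c Γ (insert (α.and β).neg Δ)
  | orL {c Γ Δ} (α β : Formula) :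
      SCder c (insert α Γ) Δ → SCder c (insert β Γ) Δ → SCder c (insert (α.or β) Γ) Δ
  | orR {c Γ Δ} (α β : Formula) :
      SCder c Γ (insert α (insert β Δ)) → SCder c Γ (insert (α.or β) Δ)
  | norL {c Γ Δ} (α β : Formula) :
      SCder c (insert α.neg (insert β.neg Γ)) Δ → SCder c (insert (α.or β).neg Γ) Δ
  | norR {c Γ Δ} (α β : Formula) :
      SCder c Γ (insert α.neg Δ) → SCder c Γ (insert β.neg Δ) →
      SCder c Γ (insert (α.or β).neg Δ)
  | nnL {c Γ Δ} (α : Formula) : SCder c (insert α Γ) Δ → SCder c (insert α.neg.neg Γ) Δ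
  | nnR {c Γ Δ} (α : Formula) : SCder c Γ (insert α Δ) → SCder c Γ (insert α.neg.neg Δ)
  | boxL1 {c Γ Δ} (α : Formula) : SCder c (insert α Γ) Δ → SCder c (insert α.box Γ) Δ
  | boxL2 {c Γ Δ} (α : Formula) : SCder c Γ (insert α.neg Δ) → SCder c (insert α.box Γ) Δ
  | boxR {c Γ Δ} (α : Formula) :
      SCder c Γ (insert α Δ) → SCder c (insert α.neg Γ) Δ → SCder c Γ (insert α.box Δ)
  | nboxL {c Γ Δ} (α : Formula) :
      SCder c Γ (insert α Δ) → SCder c (insert α.neg Γ) Δ → SCder c (insert α.box.neg Γ) Δ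
  | nboxR1 {c Γ Δ} (α : Formula) : SCder c (insert α Γ) Δ → SCder c Γ (insert α.box.neg Δ)
  | nboxR2 {c Γ Δ} (α : Formula) : SCder c Γ (insert α.neg Δ) → SCder c Γ (insert α.box.neg Δ)
/-- The four-element diamond lattice `M4 = {0, n, b, 1}`, realized as `Bool × Bool`
with `0 = (false, false)`, `n = (true, false)`, `b = (false, true)`, `1 = (true, true)`. -/
def M4 : Type := Bool × Bool

instance : DecidableEq M4 := inferInstanceAs (DecidableEq (Bool × Bool))
instance : Fintype M4 := inferInstanceAs (Fintype (Bool × Bool))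
instance : DistribLattice M4 := inferInstanceAs (DistribLattice (Bool × Bool))
instance : BoundedOrder M4 := inferInstanceAs (BoundedOrder (Bool × Bool))

/-- De Morgan negation on `M4`: `¬0 = 1`, `¬1 = 0`, `¬n = n`, `¬b = b`. -/
def m4neg (a : M4) : M4 := (!a.2, !a.1)

/-- The modal operator on `M4`: `□1 = 1` and `□0 = □n = □b = 0`. -/
def m4box (a : M4) : M4 := (a.1 && a.2, a.1 && a.2)

/-- The designated set `D = {b, 1}` of the matrix `⟨M4m, D⟩`. -/
def m4D (a : M4) : Prop := a.2 = true
/-- A valuation: a function from formulas to `M4` commuting with `∧, ∨, ¬, □`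
(interpreted by the operations of the algebra `𝔐₄ₘ`). -/
structure Val4 where
  toFun : Formula → M4
  map_and : ∀ φ ψ : Formula, toFun (φ.and ψ) = toFun φ ⊓ toFun ψ
  map_or : ∀ φ ψ : Formula, toFun (φ.or ψ) = toFun φ ⊔ toFun ψ
  map_neg : ∀ φ : Formula, toFun φ.neg = m4neg (toFun φ)
  map_box : ∀ φ : Formula, toFun φ.box = m4box (toFun φ)

namespace SCder

theorem mono {c : Bool} {Γ Γ' Δ Δ' : Finset Formula} (h : SCder c Γ Δ)
    (hΓ : Γ ⊆ Γ') (hΔ : Δ ⊆ Δ') : SCder c Γ' Δ' := by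
  have left : ∀ S : Finset Formula, SCder c (S ∪ Γ) Δ := fun S => by
    induction S using Finset.induction_on with
    | empty => simpa using h
    | insert a S _ ih => rw [Finset.insert_union]; exact weakL a ih
  have right : ∀ S : Finset Formula, SCder c Γ' (S ∪ Δ) := fun S => by
    induction S using Finset.induction_on with
    | empty => simpa [Finset.union_eq_left.2 hΓ] using left Γ'
    | insert a S _ ih => rw [Finset.insert_union]; exact weakR a ih
  simpa [Finset.union_eq_left.2 hΔ] using right Δ'

theorem of_mem {c : Bool} {Γ Δ : Finset Formula} (α : Formula) (hΓ : α ∈ Γ) (hΔ : α ∈ Δ) :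
    SCder c Γ Δ :=
  (ax c α).mono (by simpa using hΓ) (by simpa using hΔ)

end SCder

namespace Val4

variable (v : Val4) (φ ψ : Formula)

theorem designated_and : m4D (v.toFun (φ.and ψ)) ↔ m4D (v.toFun φ) ∧ m4D (v.toFun ψ) := by
  rw [v.map_and]
  generalize v.toFun φ = a
  generalize v.toFun ψ = b
  revert a b
  unfold m4D
  decide

theorem designated_or : m4D (v.toFun (φ.or ψ)) ↔ m4D (v.toFun φ) ∨ m4D (v.toFun ψ) := by
  rw [v.map_or]
  generalize v.toFun φ = a
  generalize v.toFun ψ = b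
  revert a b
  unfold m4D
  decide

theorem designated_neg_and :
    m4D (v.toFun (φ.and ψ).neg) ↔ m4D (v.toFun φ.neg) ∨ m4D (v.toFun ψ.neg) := by
  simp only [v.map_neg, v.map_and]
  generalize v.toFun φ = a
  generalize v.toFun ψ = b
  revert a b
  unfold m4D
  decide

theorem designated_neg_or :
    m4D (v.toFun (φ.or ψ).neg) ↔ m4D (v.toFun φ.neg) ∧ m4D (v.toFun ψ.neg) := by
  simp only [v.map_neg, v.map_or]
  generalize v.toFun φ = a
  generalize v.toFun ψ = b
  revert a b
  unfold m4D
  decide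

theorem designated_neg_neg : m4D (v.toFun φ.neg.neg) ↔ m4D (v.toFun φ) := by
  simp only [v.map_neg]
  generalize v.toFun φ = a
  revert a
  unfold m4D
  decide

theorem designated_box :
    m4D (v.toFun φ.box) ↔ m4D (v.toFun φ) ∧ ¬ m4D (v.toFun φ.neg) := by
  simp only [v.map_neg, v.map_box]
  generalize v.toFun φ = a
  revert a
  unfold m4D
  decide

theorem designated_neg_box :
    m4D (v.toFun φ.box.neg) ↔ (m4D (v.toFun φ) → m4D (v.toFun φ.neg)) := by
  simp only [v.map_neg, v.map_box]
  generalize v.toFun φ = a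
  revert a
  unfold m4D
  decide

end Val4

theorem SCder.sound {c : Bool} {Γ Δ : Finset Formula} (h : SCder c Γ Δ) (v : Val4) :
    (∀ γ ∈ Γ, m4D (v.toFun γ)) → ∃ δ ∈ Δ, m4D (v.toFun δ) := by
  induction h <;>
    simp only [Finset.forall_mem_insert, Finset.exists_mem_insert, Finset.mem_singleton,
      forall_eq, exists_eq_left, v.designated_and, v.designated_or, v.designated_neg_and,
      v.designated_neg_or, v.designated_neg_neg, v.designated_box, v.designated_neg_box] at * <;>
    tauto

/-- A set of formulas closed under `SC_TML`-consequence with multiple conclusions. -/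
def IsPrimeTheory (T : Set Formula) : Prop :=
  ∀ Γ Δ : Finset Formula, SCder true Γ Δ → (∀ γ ∈ Γ, γ ∈ T) → ∃ δ ∈ Δ, δ ∈ T

theorem exists_isPrimeTheory {Γ Δ : Finset Formula} (h : ¬ SCder true Γ Δ) :
    ∃ T : Set Formula, IsPrimeTheory T ∧ (∀ γ ∈ Γ, γ ∈ T) ∧ ∀ δ ∈ Δ, δ ∉ T := by
  obtain ⟨T, hΓT, hT⟩ := zorn_subset_nonempty
    {T : Set Formula | ∀ S : Finset Formula, (S : Set Formula) ⊆ T → ¬ SCder true S Δ}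
    (fun C hC hchain hne => ⟨⋃₀ C, fun S hS hd => by
      obtain ⟨T, hTC, hST⟩ := hchain.directedOn.exists_mem_subset_of_finset_subset_biUnion
        (f := id) hne (s := S) (by simpa [Set.sUnion_eq_biUnion] using hS)
      exact hC hTC S hST hd, fun s hs => Set.subset_sUnion_of_mem hs⟩)
    (Γ : Set Formula) (fun S hS hd => h (hd.mono (by exact_mod_cast hS) subset_rfl))
  have hcons := hT.prop
  have hmax : ∀ φ, φ ∉ T →
      ∃ S : Finset Formula, (S : Set Formula) ⊆ T ∧ SCder true (insert φ S) Δ := by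
    intro φ hφ
    by_contra hno
    push Not at hno
    refine hφ (hT.le_of_ge (y := insert φ T) (fun S hS hd => ?_) (Set.subset_insert _ _)
      (Set.mem_insert _ _))
    refine hno (S.erase φ) ?_ (hd.mono (by grind) subset_rfl)
    intro x hx
    have := @hS x
    grind
  have key : ∀ E : Finset Formula, (∀ δ ∈ E, δ ∉ T) →
      ∀ S : Finset Formula, (S : Set Formula) ⊆ T → ¬ SCder true S (E ∪ Δ) := by
    intro E
    induction E using Finset.induction_on with
    | empty => intro _ S hS; simpa using hcons S hS
    | insert a E _ ih =>
      intro hE S hS hd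
      rw [Finset.forall_mem_insert] at hE
      obtain ⟨S', hS', hd'⟩ := hmax a hE.1
      refine ih hE.2 (S ∪ S') (by simp [hS, hS']) (SCder.cut (α := a) ?_ ?_)
      · exact hd.mono Finset.subset_union_left (by simp)
      · exact hd'.mono (by grind) Finset.subset_union_right
  refine ⟨T, fun Γ' Δ' hd hΓ' => ?_, fun γ hγ => hΓT hγ, fun δ hδ hδT => ?_⟩
  · by_contra hno
    push Not at hno
    exact key Δ' hno Γ' hΓ' (hd.mono subset_rfl Finset.subset_union_left)
  · exact hcons {δ} (by simpa using hδT) (SCder.of_mem δ (by simp) hδ)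

namespace IsPrimeTheory

theorem and_mem {T : Set Formula} (hT : IsPrimeTheory T) (α β : Formula) :
    α.and β ∈ T ↔ α ∈ T ∧ β ∈ T := by
  have l := hT _ _ (.andL (Γ := ∅) (Δ := {α}) α β (.of_mem α (by simp) (by simp)))
  have r := hT _ _ (.andL (Γ := ∅) (Δ := {β}) α β (.of_mem β (by simp) (by simp)))
  have i := hT _ _ (.andR (Γ := {α, β}) (Δ := ∅) α β (.of_mem α (by simp) (by simp))
    (.of_mem β (by simp) (by simp)))
  simp at l r i
  tauto

theorem neg_and_mem {T : Set Formula} (hT : IsPrimeTheory T) (α β : Formula) :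
    (α.and β).neg ∈ T ↔ α.neg ∈ T ∨ β.neg ∈ T := by
  have l := hT _ _ (.nandR (Γ := {α.neg}) (Δ := ∅) α β (.of_mem α.neg (by simp) (by simp)))
  have r := hT _ _ (.nandR (Γ := {β.neg}) (Δ := ∅) α β (.of_mem β.neg (by simp) (by simp)))
  have e := hT _ _ (.nandL (Γ := ∅) (Δ := {α.neg, β.neg}) α β
    (.of_mem α.neg (by simp) (by simp)) (.of_mem β.neg (by simp) (by simp)))
  simp at l r e
  tauto

theorem or_mem {T : Set Formula} (hT : IsPrimeTheory T) (α β : Formula) :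
    α.or β ∈ T ↔ α ∈ T ∨ β ∈ T := by
  have l := hT _ _ (.orR (Γ := {α}) (Δ := ∅) α β (.of_mem α (by simp) (by simp)))
  have r := hT _ _ (.orR (Γ := {β}) (Δ := ∅) α β (.of_mem β (by simp) (by simp)))
  have e := hT _ _ (.orL (Γ := ∅) (Δ := {α, β}) α β (.of_mem α (by simp) (by simp))
    (.of_mem β (by simp) (by simp)))
  simp at l r e
  tauto

theorem neg_or_mem {T : Set Formula} (hT : IsPrimeTheory T) (α β : Formula) :
    (α.or β).neg ∈ T ↔ α.neg ∈ T ∧ β.neg ∈ T := by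
  have l := hT _ _ (.norL (Γ := ∅) (Δ := {α.neg}) α β (.of_mem α.neg (by simp) (by simp)))
  have r := hT _ _ (.norL (Γ := ∅) (Δ := {β.neg}) α β (.of_mem β.neg (by simp) (by simp)))
  have i := hT _ _ (.norR (Γ := {α.neg, β.neg}) (Δ := ∅) α β
    (.of_mem α.neg (by simp) (by simp)) (.of_mem β.neg (by simp) (by simp)))
  simp at l r i
  tauto

theorem neg_neg_mem {T : Set Formula} (hT : IsPrimeTheory T) (α : Formula) :
    α.neg.neg ∈ T ↔ α ∈ T := by
  have e := hT _ _ (.nnL (Γ := ∅) (Δ := {α}) α (.of_mem α (by simp) (by simp)))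
  have i := hT _ _ (.nnR (Γ := {α}) (Δ := ∅) α (.of_mem α (by simp) (by simp)))
  simp at e i
  tauto

theorem box_mem {T : Set Formula} (hT : IsPrimeTheory T) (α : Formula) :
    α.box ∈ T ↔ α ∈ T ∧ α.neg ∉ T := by
  have l := hT _ _ (.boxL1 (Γ := ∅) (Δ := {α}) α (.of_mem α (by simp) (by simp)))
  have r := hT _ _ (.boxL2 (Γ := {α.neg}) (Δ := ∅) α (.of_mem α.neg (by simp) (by simp)))
  have i := hT _ _ (.boxR (Γ := {α}) (Δ := {α.neg}) α (.of_mem α (by simp) (by simp))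
    (.of_mem α.neg (by simp) (by simp)))
  simp at l r i
  tauto

theorem neg_box_mem {T : Set Formula} (hT : IsPrimeTheory T) (α : Formula) :
    α.box.neg ∈ T ↔ (α ∈ T → α.neg ∈ T) := by
  have l := hT _ _ (.nboxR1 (Γ := ∅) (Δ := {α}) α (.of_mem α (by simp) (by simp)))
  have r := hT _ _ (.nboxR2 (Γ := {α.neg}) (Δ := ∅) α (.of_mem α.neg (by simp) (by simp)))
  have e := hT _ _ (.nboxL (Γ := {α}) (Δ := {α.neg}) α (.of_mem α (by simp) (by simp))
    (.of_mem α.neg (by simp) (by simp)))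
  simp at l r e
  tauto

end IsPrimeTheory

open Classical in
/-- The valuation designating exactly the members of a prime theory. -/
noncomputable def IsPrimeTheory.val {T : Set Formula} (hT : IsPrimeTheory T) : Val4 where
  toFun φ := (decide (φ.neg ∉ T), decide (φ ∈ T))
  map_and φ ψ := by
    refine Prod.ext ?_ ?_
    · change _ = (decide (φ.neg ∉ T) && decide (ψ.neg ∉ T))
      simp [hT.neg_and_mem]
    · change _ = (decide (φ ∈ T) && decide (ψ ∈ T))
      simp [hT.and_mem]
  map_or φ ψ := by
    refine Prod.ext ?_ ?_
    · change _ = (decide (φ.neg ∉ T) || decide (ψ.neg ∉ T))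
      simp [hT.neg_or_mem, imp_iff_not_or]
    · change _ = (decide (φ ∈ T) || decide (ψ ∈ T))
      simp [hT.or_mem]
  map_neg φ := by
    simp [m4neg, hT.neg_neg_mem]
    rfl
  map_box φ := by
    simp [m4box, hT.box_mem, hT.neg_box_mem]
    rw [Bool.and_comm]

theorem IsPrimeTheory.designated_val {T : Set Formula} (hT : IsPrimeTheory T) (φ : Formula) :
    m4D (hT.val.toFun φ) ↔ φ ∈ T := by
  simp [m4D, IsPrimeTheory.val]

/-- Soundness and completeness of `SC_TML` w.r.t. the matrix `⟨M4m, D⟩`. -/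
theorem sc_sound_complete (Γ Δ : Finset Formula) :
    SCder true Γ Δ ↔
      ∀ v : Val4, (∃ γ ∈ Γ, ¬ m4D (v.toFun γ)) ∨ (∃ δ ∈ Δ, m4D (v.toFun δ)) := by
  constructor
  · intro h v
    by_cases hΓ : ∀ γ ∈ Γ, m4D (v.toFun γ)
    · exact Or.inr (h.sound v hΓ)
    · push Not at hΓ
      exact Or.inl hΓ
  · intro h
    by_contra hd
    obtain ⟨T, hT, hΓ, hΔ⟩ := exists_isPrimeTheory hd
    rcases h hT.val with ⟨γ, hγ, hn⟩ | ⟨δ, hδ, hp⟩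
    · exact hn ((hT.designated_val γ).2 (hΓ γ hγ))
    · exact hΔ δ hδ ((hT.designated_val δ).1 hp)
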